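/- arXiv:2206.15319 — 2 statements merged into one kernel-verified Lean document; each statement's English description precedes it below -/
import Mathlib

section
/- Let α ∈ (0,1) be irrational, ρ ∈ [0,1), let s = s_{α,ρ} be the Sturmian word of slope α and intercept ρ, and let ℓ ≥ 2. For a length-ℓ word w ∈ {0,1}^ℓ set I_w := {x ∈ [0,1) : ∀ i < ℓ, w_i = 0 ⟺ {x + iα} ∈ [0,1−α)}. Then for all n, m > ℓ: if ∂_{s,ℓ}[n] = ∂_{s,ℓ}[m], then for every j ∈ {0,…,ℓ} and every length-ℓ factor w of s, {(n−j)α} ∈ I_w if and only if {(m−j)α} ∈ I_w. (Equivalently, distinct constellations of the rotated points determine distinct boundary sets.) -/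
/-- The Sturmian word of slope `α` and intercept `ρ`:
`s[n] = 0` iff `{ρ + nα} ∈ [0, 1−α)`. -/
noncomputable def sturmian (α ρ : ℝ) (n : ℕ) : Fin 2 :=
  if Int.fract (ρ + n * α) < 1 - α then 0 else 1

/-- The `n`-th boundary set of the infinite word `x` with window length `ℓ`. -/
def boundarySet {A : Type*} (x : ℕ → A) (ℓ n : ℕ) :
    Set ((Fin ℓ → A) × (Fin ℓ → A)) :=
  {p | ∃ i : ℕ, (∀ k : Fin ℓ, p.1 k = x (i + k)) ∧ (∀ k : Fin ℓ, p.2 k = x (i + n + k))}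

/-- A degree-one lattice staircase `b`, read modulo its period `L ≥ 3`, determines the residues
of the values of `b`. -/
theorem residue_eq_of_staircase_eq {L : ℤ} (hL : 3 ≤ L) {b b' : ℤ → ℤ}
    (hb : Monotone b) (hb' : Monotone b')
    (hbL : ∀ a, b (a + L) = b a + L) (hbL' : ∀ a, b' (a + L) = b' a + L)
    (h : ∀ a c : ℤ, (∃ k : ℤ, b a ≤ c + k * L ∧ c + k * L ≤ b (a + 1)) ↔
      ∃ k : ℤ, b' a ≤ c + k * L ∧ c + k * L ≤ b' (a + 1)) (a : ℤ) :
    ∃ k : ℤ, b' a = b a + k * L := by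
  obtain ⟨p, hp1, hp2⟩ := (h (a - 1) (b a)).1 ⟨0, by simpa using hb (by omega), by simp⟩
  obtain ⟨q, hq1, hq2⟩ := (h a (b a)).1 ⟨0, by simp, by simpa using hb (by omega)⟩
  rw [sub_add_cancel] at hp2
  by_contra hne
  have hlt1 : b a + p * L < b' a := lt_of_le_of_ne hp2 fun e => hne ⟨p, e.symm⟩
  have hlt2 : b' a < b a + q * L := lt_of_le_of_ne hq1 fun e => hne ⟨q, e⟩
  have hwrap : b' (a + 1) ≤ b' (a - 1) + L := by
    rw [← hbL']; exact hb' (by omega)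
  have hpq : q = p + 1 := by
    have h1 : p < q := by nlinarith
    have h2 : q ≤ p + 1 := by nlinarith
    omega
  subst hpq
  have hD : ∀ x, a + 1 ≤ x → x ≤ a - 1 + L → b' x = b a + (p + 1) * L := by
    intro x h1 h2
    have h3 := hb' h1
    have h4 := hb' h2
    rw [hbL'] at h4
    nlinarith
  -- the residue of `b' a` lies in columns `a - 1` and `a`
  obtain ⟨r, hr1, hr2⟩ := (h a (b' a)).2 ⟨0, by simp, by simpa using hb' (by omega)⟩
  obtain ⟨t, ht1, ht2⟩ := (h (a - 1) (b' a)).2 ⟨0, by simpa using hb' (by omega), by simp⟩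
  rw [sub_add_cancel] at ht2
  have hcol : ∀ x, a + 1 ≤ x → x + 1 ≤ a - 1 + L → ∀ c, b x ≤ c → c ≤ b (x + 1) →
      ∃ k : ℤ, c = b a + k * L := by
    intro x h1 h2 c hc1 hc2
    obtain ⟨k, hk1, hk2⟩ := (h x c).1 ⟨0, by simpa using hc1, by simpa using hc2⟩
    rw [hD x h1 (by omega)] at hk1
    rw [hD (x + 1) (by omega) h2] at hk2
    exact ⟨p + 1 - k, by linarith⟩
  have hstep : ∀ x, a + 1 ≤ x → x + 1 ≤ a - 1 + L → b (x + 1) = b x := by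
    intro x h1 h2
    by_contra hx
    have hlt : b x + 1 ≤ b (x + 1) := lt_of_le_of_ne (hb (by omega)) (Ne.symm hx)
    obtain ⟨k, hk⟩ := hcol x h1 h2 (b x) le_rfl (by omega)
    obtain ⟨k', hk'⟩ := hcol x h1 h2 (b x + 1) (by omega) hlt
    have : (k' - k) * L = 1 := by linarith
    have := Int.eq_one_or_neg_one_of_mul_eq_one' this
    omega
  have hconst : ∀ i : ℕ, (a + 1 + i ≤ a - 1 + L) → b (a + 1 + i) = b (a + 1) := by
    intro i
    induction i with
    | zero => simp
    | succ i ih =>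
      intro hi
      push_cast at hi ⊢
      rw [← add_assoc, hstep _ (by omega) (by omega), ih (by omega)]
  have hB : b (a - 1) + L = b (a + 1) := by
    have := hconst (L - 2).toNat (by omega)
    rw [← this, ← hbL]; congr 1; omega
  obtain ⟨s, hs⟩ := hcol (a + 1) le_rfl (by omega) (b (a + 1)) le_rfl (hb (by omega))
  have hm1 : b (a - 1) ≤ b a := hb (by omega)
  have hm2 : b a ≤ b (a + 1) := hb (by omega)
  have hs0 : 0 ≤ s := by by_contra hcon; nlinarith [not_le.1 hcon]
  have hs1 : s ≤ 1 := by by_contra hcon; nlinarith [not_le.1 hcon]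
  obtain rfl | rfl : s = 0 ∨ s = 1 := by omega
  · exact hne ⟨-r, by linarith⟩
  · exact hne ⟨-t, by linarith⟩

/-- Forward orbits of an irrational rotation meet every open interval modulo `1`. -/
theorem exists_nat_add_mul_mem_Ioo {α : ℝ} (hirr : Irrational α) (ρ : ℝ) {u v : ℝ}
    (huv : u < v) : ∃ (i : ℕ) (k : ℤ), ρ + i * α + k ∈ Set.Ioo u v := by
  have : Fact ((0 : ℝ) < 1) := ⟨one_pos⟩
  have h1 : DenseRange (fun i : ℕ => i • (α : AddCircle (1 : ℝ))) :=
    denseRange_zsmul_iff_nsmul.1 (AddCircle.denseRange_zsmul_coe_iff.2 (by simpa using hirr))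
  have hopen : IsOpen ((fun x : ℝ => (x : AddCircle (1 : ℝ))) '' Set.Ioo (u - ρ) (v - ρ)) :=
    QuotientAddGroup.isOpenMap_coe _ isOpen_Ioo
  obtain ⟨i, y, hy, hyi⟩ := h1.exists_mem_open hopen
    ((Set.nonempty_Ioo.2 (by linarith)).image _)
  have h0 : ((y - i * α : ℝ) : AddCircle (1 : ℝ)) = 0 := by
    rw [AddCircle.coe_sub, sub_eq_zero, ← nsmul_eq_mul, AddCircle.coe_nsmul]
    exact hyi
  obtain ⟨k, hk⟩ := AddCircle.coe_eq_zero_iff (1 : ℝ) |>.1 h0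
  have hk' : (k : ℝ) = y - i * α := by simpa using hk
  refine ⟨i, k, ?_⟩
  rw [hk']
  constructor <;> linarith [hy.1, hy.2]

/-- The sum of the floors of `x, x + α, …, x + ℓα`. Modulo `ℓ + 1` it indexes the length-`ℓ` window
read at the point `x`. -/
noncomputable def floorSum (α : ℝ) (ℓ : ℕ) (x : ℝ) : ℤ :=
  ∑ k ∈ Finset.range (ℓ + 1), ⌊x + k * α⌋

/-- The length-`ℓ` word coding the orbit of the point `x`. -/
noncomputable def orbitWindow (α : ℝ) (ℓ : ℕ) (x : ℝ) (k : Fin ℓ) : Fin 2 :=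
  if Int.fract (x + (k : ℕ) * α) < 1 - α then 0 else 1

theorem floorSum_mono (α : ℝ) (ℓ : ℕ) : Monotone (floorSum α ℓ) := fun _ _ hxy =>
  Finset.sum_le_sum fun _ _ => Int.floor_mono (by linarith)

theorem floorSum_add_int (α : ℝ) (ℓ : ℕ) (x : ℝ) (n : ℤ) :
    floorSum α ℓ (x + n) = floorSum α ℓ x + n * (ℓ + 1) := by
  have h : ∀ k : ℕ, ⌊x + n + k * α⌋ = ⌊x + k * α⌋ + n := fun k => by
    rw [← Int.floor_add_intCast]; congr 1; ring
  simp only [floorSum, h, Finset.sum_add_distrib]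
  simp [mul_comm]

/-- `floorSum` jumps at each point `n - jα` with `j ≤ ℓ`. -/
theorem floorSum_lt_of_lt {α : ℝ} {ℓ j : ℕ} (hj : j ≤ ℓ) (n : ℤ) {y : ℝ} (hy : y < n - j * α) :
    floorSum α ℓ y < floorSum α ℓ (n - j * α) := by
  refine Finset.sum_lt_sum (fun _ _ => Int.floor_mono (by linarith))
    ⟨j, Finset.mem_range.2 (by omega), ?_⟩
  rw [sub_add_cancel, Int.floor_intCast]
  exact Int.floor_lt.2 (by linarith)

theorem fract_lt_one_sub_iff {α : ℝ} (hα0 : 0 < α) (z : ℝ) :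
    Int.fract z < 1 - α ↔ ⌊z + α⌋ = ⌊z⌋ := by
  rw [Int.floor_eq_iff, Int.fract]
  have := Int.floor_le z
  constructor
  · intro h; constructor <;> linarith
  · intro h; linarith [h.2]

theorem floor_add_of_not_fract_lt {α : ℝ} (hα1 : α < 1) {z : ℝ} (hz : ¬ Int.fract z < 1 - α) :
    ⌊z + α⌋ = ⌊z⌋ + 1 := by
  rw [Int.floor_eq_iff]
  rw [Int.fract] at hz
  have := Int.lt_floor_add_one z
  push_cast
  constructor <;> linarith

theorem orbitWindow_eq_of_floor_eq {α : ℝ} (hα0 : 0 < α) {ℓ : ℕ} {x y : ℝ} {d : ℤ}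
    (h : ∀ k : ℕ, k ≤ ℓ → ⌊y + k * α⌋ = ⌊x + k * α⌋ + d) :
    orbitWindow α ℓ x = orbitWindow α ℓ y := by
  funext k
  have h1 := h k k.2.le
  have h2 := h (k + 1) k.2
  have e : ∀ z : ℝ, z + ((k + 1 : ℕ) : ℝ) * α = z + (k : ℕ) * α + α := fun z => by
    push_cast; ring
  rw [e, e] at h2
  simp only [orbitWindow, fract_lt_one_sub_iff hα0]
  congr 1
  rw [h1, h2, add_left_inj]

theorem floor_eq_of_orbitWindow_eq {α : ℝ} (hα0 : 0 < α) (hα1 : α < 1) {ℓ : ℕ} {x y : ℝ}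
    (h : orbitWindow α ℓ x = orbitWindow α ℓ y) (k : ℕ) (hk : k ≤ ℓ) :
    ⌊y + k * α⌋ = ⌊x + k * α⌋ + (⌊y⌋ - ⌊x⌋) := by
  induction k with
  | zero => simp
  | succ k ih =>
    have ih := ih (by omega)
    have e : ∀ z : ℝ, z + ((k + 1 : ℕ) : ℝ) * α = z + k * α + α := fun z => by
      push_cast; ring
    rw [e, e]
    have hw := congrFun h ⟨k, hk⟩
    simp only [orbitWindow] at hw
    by_cases hx : Int.fract (x + k * α) < 1 - α <;> by_cases hy : Int.fract (y + k * α) < 1 - α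
    · rw [(fract_lt_one_sub_iff hα0 _).1 hx, (fract_lt_one_sub_iff hα0 _).1 hy, ih]
    · simp [hx, hy] at hw
    · simp [hx, hy] at hw
    · rw [floor_add_of_not_fract_lt hα1 hx, floor_add_of_not_fract_lt hα1 hy, ih]; ring

theorem floor_eq_of_floorSum_eq {α : ℝ} {ℓ : ℕ} {x y : ℝ} (h : floorSum α ℓ x = floorSum α ℓ y)
    (k : ℕ) (hk : k ≤ ℓ) : ⌊x + k * α⌋ = ⌊y + k * α⌋ := by
  wlog hxy : x ≤ y generalizing x y
  · exact (this h.symm (le_of_not_ge hxy)).symm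
  · exact (Finset.sum_eq_sum_iff_of_le fun _ _ => Int.floor_mono (by linarith)).1 h k
      (Finset.mem_range.2 (by omega))

theorem orbitWindow_eq_iff {α : ℝ} (hα0 : 0 < α) (hα1 : α < 1) {ℓ : ℕ} {x y : ℝ} :
    orbitWindow α ℓ x = orbitWindow α ℓ y ↔
      ∃ k : ℤ, floorSum α ℓ y = floorSum α ℓ x + k * (ℓ + 1) := by
  constructor
  · intro h
    refine ⟨⌊y⌋ - ⌊x⌋, ?_⟩
    rw [floorSum, floorSum, Finset.sum_congr rfl fun k hk =>
      floor_eq_of_orbitWindow_eq hα0 hα1 h k (by simpa [Nat.lt_succ_iff] using hk),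
      Finset.sum_add_distrib]
    simp only [Finset.sum_const, Finset.card_range, nsmul_eq_mul]
    push_cast; ring
  · rintro ⟨k, hk⟩
    rw [← floorSum_add_int] at hk
    refine orbitWindow_eq_of_floor_eq hα0 (d := k) fun i hi => ?_
    rw [floor_eq_of_floorSum_eq hk i hi, ← Int.floor_add_intCast]
    congr 1; ring

/-- Every integer is the value of `floorSum` at some point `n - jα` with `j ≤ ℓ`. -/
theorem exists_floorSum_eq {α : ℝ} (hirr : Irrational α) (ℓ : ℕ) (a : ℤ) :
    ∃ (n : ℤ) (j : ℕ), j ≤ ℓ ∧ floorSum α ℓ (n - j * α) = a := by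
  let f : Fin (ℓ + 1) → ZMod (ℓ + 1) := fun j => (floorSum α ℓ ((0 : ℤ) - (j : ℕ) * α) : ℤ)
  have hf : Function.Injective f := by
    intro i j hij
    obtain ⟨k, hk⟩ := (ZMod.intCast_eq_intCast_iff_dvd_sub _ _ _).1 hij
    have hk' : floorSum α ℓ ((k : ℤ) - (i : ℕ) * α) = floorSum α ℓ ((0 : ℤ) - (j : ℕ) * α) := by
      have := floorSum_add_int α ℓ ((0 : ℤ) - (i : ℕ) * α) k
      rw [show ((0 : ℤ) - (i : ℕ) * α : ℝ) + k = k - (i : ℕ) * α by push_cast; ring] at this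
      rw [this]
      push_cast at hk ⊢
      linarith
    have h1 : (k : ℝ) - (i : ℕ) * α = ((0 : ℤ) : ℝ) - (j : ℕ) * α := by
      rcases lt_trichotomy ((k : ℝ) - (i : ℕ) * α) (((0 : ℤ) : ℝ) - (j : ℕ) * α) with h | h | h
      · exact absurd hk' (floorSum_lt_of_lt (Nat.lt_succ_iff.1 j.2) 0 h).ne
      · exact h
      · exact absurd hk'.symm (floorSum_lt_of_lt (Nat.lt_succ_iff.1 i.2) k h).ne
    by_contra hne
    have hne' : ((i : ℕ) : ℤ) - ((j : ℕ) : ℤ) ≠ 0 := by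
      have : (i : ℕ) ≠ j := fun h => hne (Fin.ext h)
      omega
    refine (hirr.intCast_mul hne').ne_int k ?_
    push_cast at h1 ⊢
    linarith
  obtain ⟨j, hj⟩ := ((Fintype.bijective_iff_injective_and_card f).2
    ⟨hf, by simp⟩).2 (a : ZMod (ℓ + 1))
  obtain ⟨k, hk⟩ := (ZMod.intCast_eq_intCast_iff_dvd_sub _ _ _).1 hj
  refine ⟨k, j, Nat.lt_succ_iff.1 j.2, ?_⟩
  have := floorSum_add_int α ℓ ((0 : ℤ) - (j : ℕ) * α) k
  rw [show ((0 : ℤ) - (j : ℕ) * α : ℝ) + k = k - (j : ℕ) * α by push_cast; ring] at this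
  rw [this]
  push_cast at hk ⊢
  linarith

/-- The point where `floorSum` reaches the value `a`. -/
noncomputable def jump (α : ℝ) (ℓ : ℕ) (a : ℤ) : ℝ :=
  sInf {x | a ≤ floorSum α ℓ x}

theorem jump_floorSum {α : ℝ} {ℓ j : ℕ} (hj : j ≤ ℓ) (n : ℤ) :
    jump α ℓ (floorSum α ℓ (n - j * α)) = n - j * α :=
  IsLeast.csInf_eq ⟨le_refl (floorSum α ℓ (n - j * α)), fun _ hy => not_lt.1 fun h =>
    (floorSum_lt_of_lt hj n h).not_ge hy⟩

theorem exists_jump_eq {α : ℝ} (hirr : Irrational α) (ℓ : ℕ) (a : ℤ) :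
    ∃ (n : ℤ) (j : ℕ), j ≤ ℓ ∧ jump α ℓ a = n - j * α := by
  obtain ⟨n, j, hj, rfl⟩ := exists_floorSum_eq hirr ℓ a
  exact ⟨n, j, hj, jump_floorSum hj n⟩

theorem floorSum_jump {α : ℝ} (hirr : Irrational α) (ℓ : ℕ) (a : ℤ) :
    floorSum α ℓ (jump α ℓ a) = a := by
  obtain ⟨n, j, hj, rfl⟩ := exists_floorSum_eq hirr ℓ a
  rw [jump_floorSum hj n]

theorem le_floorSum_iff {α : ℝ} (hirr : Irrational α) {ℓ : ℕ} {a : ℤ} {x : ℝ} :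
    a ≤ floorSum α ℓ x ↔ jump α ℓ a ≤ x := by
  constructor
  · intro h
    obtain ⟨n, j, hj, rfl⟩ := exists_floorSum_eq hirr ℓ a
    rw [jump_floorSum hj n]
    exact not_lt.1 fun h' => (floorSum_lt_of_lt hj n h').not_ge h
  · intro h
    rw [← floorSum_jump hirr ℓ a]
    exact floorSum_mono α ℓ h

/-- The pairs of values of `floorSum` along `x ↦ (x, x + nα)` form a lattice staircase. -/
theorem exists_floorSum_pair_iff {α : ℝ} (hirr : Irrational α) {ℓ n : ℕ} (hn : ℓ < n) (a c : ℤ) :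
    (∃ x : ℝ, floorSum α ℓ x = a ∧ floorSum α ℓ (x + n * α) = c) ↔
      floorSum α ℓ (jump α ℓ a + n * α) ≤ c ∧
        c ≤ floorSum α ℓ (jump α ℓ (a + 1) + n * α) := by
  constructor
  · rintro ⟨x, rfl, rfl⟩
    constructor
    · exact floorSum_mono α ℓ 
        (by linarith [(le_floorSum_iff hirr (ℓ := ℓ) (x := x)).1 le_rfl])
    · refine floorSum_mono α ℓ ?_
      have : x < jump α ℓ (floorSum α ℓ x + 1) := by
        rw [← not_le, ← le_floorSum_iff hirr]; omega
      linarith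
  · rintro ⟨h1, h2⟩
    rcases le_or_gt (jump α ℓ c) (jump α ℓ a + n * α) with h | h
    · exact ⟨jump α ℓ a, floorSum_jump hirr ℓ a, le_antisymm h1 ((le_floorSum_iff hirr).2 h)⟩
    refine ⟨jump α ℓ c - n * α, ?_, by rw [sub_add_cancel, floorSum_jump hirr]⟩
    refine le_antisymm ?_ ((le_floorSum_iff hirr).2 (by linarith))
    rw [← Int.lt_add_one_iff, ← not_le, le_floorSum_iff hirr, not_le]
    rw [le_floorSum_iff hirr] at h2
    refine lt_of_le_of_ne (by linarith) fun he => ?_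
    obtain ⟨p, i, hi, hc⟩ := exists_jump_eq hirr ℓ c
    obtain ⟨q, j, hj, ha⟩ := exists_jump_eq hirr ℓ (a + 1)
    rw [hc, ha] at he
    refine (hirr.intCast_mul (m := (i : ℤ) + n - j) (by omega)).ne_int (p - q) ?_
    push_cast
    linarith

theorem sturmian_add (α ρ : ℝ) (ℓ i : ℕ) (k : Fin ℓ) (m : ℤ) :
    sturmian α ρ (i + k) = orbitWindow α ℓ (ρ + i * α + m) k := by
  have : ρ + i * α + m + (k : ℕ) * α = ρ + ((i + k : ℕ) : ℝ) * α + m := by push_cast; ring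
  rw [sturmian, orbitWindow, this, Int.fract_add_intCast]

theorem mem_boundarySet_sturmian_iff {α : ℝ} (hα0 : 0 < α) (hα1 : α < 1) (hirr : Irrational α)
    (ρ : ℝ) (ℓ n : ℕ) (u v : Fin ℓ → Fin 2) :
    (u, v) ∈ boundarySet (sturmian α ρ) ℓ n ↔
      ∃ x : ℝ, u = orbitWindow α ℓ x ∧ v = orbitWindow α ℓ (x + n * α) := by
  have hshift : ∀ (i : ℕ) (m : ℤ),
      ρ + ((i + n : ℕ) : ℝ) * α + m = ρ + i * α + m + n * α := fun i m => by push_cast; ring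
  constructor
  · rintro ⟨i, hu, hv⟩
    refine ⟨ρ + i * α + (0 : ℤ), funext fun k => ?_, funext fun k => ?_⟩
    · rw [← sturmian_add]; exact hu k
    · rw [← hshift, ← sturmian_add]; exact hv k
  · rintro ⟨x, rfl, rfl⟩
    have hlt : ∀ y, y < jump α ℓ (floorSum α ℓ y + 1) := fun y => by
      rw [← not_le, ← le_floorSum_iff hirr]; omega
    have hconst : ∀ y z, y ≤ z → z < jump α ℓ (floorSum α ℓ y + 1) →
        orbitWindow α ℓ y = orbitWindow α ℓ z := fun y z hyz hz => by
      rw [orbitWindow_eq_iff hα0 hα1]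
      refine ⟨0, ?_⟩
      have := floorSum_mono α ℓ hyz
      rw [← not_le, ← le_floorSum_iff hirr] at hz
      omega
    obtain ⟨i, m, hi1, hi2⟩ := exists_nat_add_mul_mem_Ioo hirr ρ
      (lt_min (hlt x) (lt_sub_iff_add_lt.2 (hlt (x + n * α))))
    rw [lt_min_iff] at hi2
    refine ⟨i, fun k => ?_, fun k => ?_⟩
    · rw [sturmian_add α ρ ℓ i k m]
      exact congrFun (hconst _ _ hi1.le hi2.1) k
    · rw [sturmian_add α ρ ℓ (i + n) k m, hshift]
      exact congrFun (hconst _ _ (by linarith) (by linarith [hi2.2])) k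

theorem orbitWindow_eq_of_boundarySet_eq {α : ℝ} (hα0 : 0 < α) (hα1 : α < 1)
    (hirr : Irrational α) {ρ : ℝ} {ℓ n m : ℕ} (hℓ : 2 ≤ ℓ) (hn : ℓ < n) (hm : ℓ < m)
    (h : boundarySet (sturmian α ρ) ℓ n = boundarySet (sturmian α ρ) ℓ m) {j : ℕ} (hj : j ≤ ℓ) :
    orbitWindow α ℓ (((n - j : ℕ) : ℝ) * α) = orbitWindow α ℓ (((m - j : ℕ) : ℝ) * α) := by
  let b : ℕ → ℤ → ℤ := fun N a => floorSum α ℓ (jump α ℓ a + N * α)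
  have hjmono : Monotone (jump α ℓ) := fun a a' haa' => by
    rw [← le_floorSum_iff hirr, floorSum_jump hirr]; exact haa'
  have hb : ∀ N, Monotone (b N) := fun N a a' haa' =>
    floorSum_mono α ℓ (by linarith [hjmono haa'])
  have hbL : ∀ N a, b N (a + ((ℓ : ℤ) + 1)) = b N a + ((ℓ : ℤ) + 1) := fun N a => by
    obtain ⟨p, i, hi, rfl⟩ := exists_floorSum_eq hirr ℓ a
    have e : (p : ℝ) - i * α + (1 : ℤ) = (p + 1 : ℤ) - i * α := by push_cast; ring
    have h1 := floorSum_add_int α ℓ (p - i * α) 1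
    have h2 := floorSum_add_int α ℓ (p - i * α + N * α) 1
    rw [one_mul] at h1 h2
    simp only [b]
    rw [← h1, jump_floorSum hi, ← h2, e, jump_floorSum hi, ← e]
    congr 1; ring
  have hpair : ∀ N : ℕ, ℓ < N → ∀ a c : ℤ,
      (∃ k : ℤ, b N a ≤ c + k * ((ℓ : ℤ) + 1) ∧ c + k * ((ℓ : ℤ) + 1) ≤ b N (a + 1)) ↔
        (orbitWindow α ℓ (jump α ℓ a), orbitWindow α ℓ (jump α ℓ c)) ∈
          boundarySet (sturmian α ρ) ℓ N := fun N hN a c => by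
    rw [mem_boundarySet_sturmian_iff hα0 hα1 hirr]
    simp only [orbitWindow_eq_iff hα0 hα1, b, ← exists_floorSum_pair_iff hirr hN,
      floorSum_jump hirr]
    constructor
    · rintro ⟨k, x, hx1, hx2⟩
      exact ⟨x, ⟨0, by simpa using hx1⟩, ⟨k, hx2⟩⟩
    · rintro ⟨x, ⟨k, hx1⟩, ⟨k', hx2⟩⟩
      refine ⟨k' - k, x + (-k : ℤ), ?_, ?_⟩
      · rw [floorSum_add_int, hx1]; ring
      · rw [show x + (-k : ℤ) + N * α = x + N * α + (-k : ℤ) by ring, floorSum_add_int, hx2]; ring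
  obtain ⟨k, hk⟩ := residue_eq_of_staircase_eq (L := (ℓ : ℤ) + 1) (by omega) (hb n) (hb m)
    (hbL n) (hbL m) (fun a c => by rw [hpair n hn, hpair m hm, h])
    (floorSum α ℓ ((0 : ℤ) - j * α))
  have e : ∀ N : ℕ, ℓ < N → ((N - j : ℕ) : ℝ) * α = ((0 : ℤ) : ℝ) - j * α + N * α := fun N hN => by
    rw [Nat.cast_sub (by omega)]; push_cast; ring
  rw [orbitWindow_eq_iff hα0 hα1, e n hn, e m hm]
  simp only [b, jump_floorSum hj] at hk
  exact ⟨k, hk⟩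

/-- for a Sturmian word `s` of irrational slope `α ∈ (0,1)` and intercept
`ρ` and `ℓ ≥ 2`: if `∂_{s,ℓ}[n] = ∂_{s,ℓ}[m]` for `n, m > ℓ`, then for every
`j ∈ {0,…,ℓ}` and every length-`ℓ` factor `w` of `s`, the point `{(n−j)α}` lies in the
interval `I_w` iff `{(m−j)α}` does (where `I_w = {x ∈ [0,1) : ∀ i < ℓ,
wᵢ = 0 ⟺ {x + iα} ∈ [0,1−α)}`): distinct constellations give distinct boundary sets. -/
theorem stmt18 (α : ℝ) (hα0 : 0 < α) (hα1 : α < 1) (hirr : Irrational α)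
    (ρ : ℝ) (hρ0 : 0 ≤ ρ) (hρ1 : ρ < 1) (ℓ : ℕ) (hℓ : 2 ≤ ℓ)
    (n m : ℕ) (hn : ℓ < n) (hm : ℓ < m)
    (hbd : boundarySet (sturmian α ρ) ℓ n = boundarySet (sturmian α ρ) ℓ m) :
    ∀ j : ℕ, j ≤ ℓ → ∀ w : Fin ℓ → Fin 2,
      (∃ i : ℕ, ∀ k : Fin ℓ, w k = sturmian α ρ (i + k)) →
      ((∀ k : Fin ℓ,
          (w k = 0 ↔ Int.fract (((n - j : ℕ) : ℝ) * α + (k : ℕ) * α) < 1 - α)) ↔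
        (∀ k : Fin ℓ,
          (w k = 0 ↔ Int.fract (((m - j : ℕ) : ℝ) * α + (k : ℕ) * α) < 1 - α))) := by
  intro j hj w _
  have hw : ∀ N : ℕ, (∀ k : Fin ℓ,
      (w k = 0 ↔ Int.fract (((N - j : ℕ) : ℝ) * α + (k : ℕ) * α) < 1 - α)) ↔
        w = orbitWindow α ℓ (((N - j : ℕ) : ℝ) * α) := fun N => by
    rw [funext_iff]
    refine forall_congr' fun k => ?_
    rw [orbitWindow]
    split_ifs with hk
    · simp [hk]
    · simp only [hk, iff_false]
      omega
  rw [hw, hw, orbitWindow_eq_of_boundarySet_eq hα0 hα1 hirr hℓ hn hm hbd hj]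
end

section
/- Let α ∈ (0,1) be irrational, ρ ∈ [0,1), let s = s_{α,ρ} be the Sturmian word of slope α and intercept ρ, and let r ≥ 1 be the maximal integer such that (01)^r appears as a factor of s (i.e., (01)^r is a factor of s but (01)^{r+1} is not). Then the boundary sequence of s, viewed as the infinite word y defined by y[n] := ∂_s[n+1] for n ≥ 0, has factor complexity p_y(n) = n + 1 for 1 ≤ n < 2r and p_y(n) = n + 2 for n ≥ 2r. -/
/-- The `n`-th boundary set (window length `1`) of an infinite binary word. -/
def boundarySet1 (x : ℕ → Fin 2) (n : ℕ) : Set (Fin 2 × Fin 2) :=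
  {p | ∃ i : ℕ, p = (x i, x (i + n))}

/-- `(01)^r` occurs in the word `x`. -/
def zeroOnePowOccurs (x : ℕ → Fin 2) (r : ℕ) : Prop :=
  ∃ i : ℕ, ∀ j < r, x (i + 2 * j) = 0 ∧ x (i + 2 * j + 1) = 1

/-- The words of length `n` read along the rotation by `a` through the interval `[0, d)`. -/
def rotationWords (a d : ℝ) (n : ℕ) : Set (Fin n → Prop) :=
  Set.range fun (z : ℝ) (k : Fin n) => Int.fract (z + k * a) < d

lemma exists_nat_int_mem_Ioo {θ : ℝ} (h : Irrational θ) {u v : ℝ} (huv : u < v) :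
    ∃ (i : ℕ) (M : ℤ), u < i * θ + M ∧ i * θ + M < v := by
  have hd : DenseRange (· • (θ : AddCircle (1 : ℝ)) : ℕ → AddCircle (1 : ℝ)) :=
    denseRange_zsmul_iff_nsmul.1 (AddCircle.denseRange_zsmul_coe_iff.2 (by simpa using h))
  obtain ⟨i, x, hx, hxi⟩ := hd.exists_mem_open
    (QuotientAddGroup.isOpenMap_coe (N := AddSubgroup.zmultiples (1 : ℝ)) _
      (isOpen_Ioo (a := u) (b := v)))
    ((Set.nonempty_Ioo.2 huv).image _)
  have h0 : ((x - i * θ : ℝ) : AddCircle (1 : ℝ)) = 0 := by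
    rw [AddCircle.coe_sub, ← nsmul_eq_mul, AddCircle.coe_nsmul, sub_eq_zero]
    exact hxi
  obtain ⟨M, hM⟩ := AddCircle.coe_eq_zero_iff _ |>.1 h0
  have hM' : (i : ℝ) * θ + M = x := by
    rw [zsmul_eq_mul, mul_one] at hM
    linarith
  exact ⟨i, M, hM' ▸ hx.1, hM' ▸ hx.2⟩

lemma exists_fract_lt_iff_right (y t : ℝ) :
    ∃ ε > 0, ∀ δ, 0 ≤ δ → δ < ε → (Int.fract (y + δ) < t ↔ Int.fract y < t) := by
  have key : ∀ δ, 0 ≤ δ → δ < 1 - Int.fract y → Int.fract (y + δ) = Int.fract y + δ := by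
    intro δ h0 h1
    rw [Int.fract_eq_iff]
    have := Int.fract_nonneg y
    refine ⟨by linarith, by linarith, ⌊y⌋, ?_⟩
    rw [← Int.self_sub_floor]; ring
  have h1 := Int.fract_lt_one y
  by_cases h : Int.fract y < t
  · refine ⟨min (1 - Int.fract y) (t - Int.fract y), lt_min (by linarith) (by linarith), ?_⟩
    intro δ h0 hδ
    obtain ⟨hδ1, hδ2⟩ := lt_min_iff.1 hδ
    rw [key δ h0 hδ1]
    exact ⟨fun _ => h, fun _ => by linarith⟩
  · refine ⟨1 - Int.fract y, by linarith, ?_⟩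
    intro δ h0 hδ
    rw [key δ h0 hδ]
    exact ⟨fun _ => by linarith, fun h' => absurd h' h⟩

/-- Every finite pattern seen along some orbit of an irrational rotation is seen along the forward
orbit of `ρ`. -/
lemma exists_nat_fract_lt_iff {θ : ℝ} (h : Irrational θ) (ρ t x : ℝ) (K : ℕ) :
    ∃ i : ℕ, ∀ k < K,
      (Int.fract (ρ + ((i + k : ℕ) : ℝ) * θ) < t ↔ Int.fract (x + k * θ) < t) := by
  have hε : ∃ ε > 0, ∀ k < K, ∀ δ, 0 ≤ δ → δ < ε →
      (Int.fract (x + k * θ + δ) < t ↔ Int.fract (x + k * θ) < t) := by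
    induction K with
    | zero => exact ⟨1, one_pos, by simp⟩
    | succ K ih =>
      obtain ⟨ε, hε, hK⟩ := ih
      obtain ⟨ε', hε', hK'⟩ := exists_fract_lt_iff_right (x + K * θ) t
      refine ⟨min ε ε', lt_min hε hε', fun k hk δ h0 hδ => ?_⟩
      obtain ⟨h1, h2⟩ := lt_min_iff.1 hδ
      rcases Nat.lt_succ_iff_lt_or_eq.1 hk with hk | rfl
      · exact hK k hk δ h0 h1
      · exact hK' δ h0 h2
  obtain ⟨ε, hε, hK⟩ := hε
  obtain ⟨i, M, h1, h2⟩ := exists_nat_int_mem_Ioo h (show x - ρ < x - ρ + ε by linarith)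
  refine ⟨i, fun k hk => ?_⟩
  rw [← hK k hk (i * θ + M - (x - ρ)) (by linarith) (by linarith),
    ← Int.fract_add_intCast (ρ + ((i + k : ℕ) : ℝ) * θ) M]
  push_cast
  ring_nf

lemma sturmian_eq_zero_iff {α ρ : ℝ} {n : ℕ} :
    sturmian α ρ n = 0 ↔ Int.fract (ρ + n * α) < 1 - α := by
  unfold sturmian; split_ifs with h <;> simp [h]

lemma sturmian_eq_one_iff {α ρ : ℝ} {n : ℕ} :
    sturmian α ρ n = 1 ↔ ¬ Int.fract (ρ + n * α) < 1 - α := by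
  unfold sturmian; split_ifs with h <;> simp [h]

lemma exists_sturmian_eq_iff {α : ℝ} (h : Irrational α) (ρ x : ℝ) (K : ℕ) :
    ∃ i : ℕ, ∀ k < K, sturmian α ρ (i + k) = sturmian α x k := by
  obtain ⟨i, hi⟩ := exists_nat_fract_lt_iff h ρ (1 - α) x K
  refine ⟨i, fun k hk => ?_⟩
  unfold sturmian
  simp only [hi k hk]

lemma mem_boundarySet1_iff {α : ℝ} (h : Irrational α) (ρ : ℝ) (m : ℕ) (p : Fin 2 × Fin 2) :
    p ∈ boundarySet1 (sturmian α ρ) m ↔ ∃ x : ℝ, sturmian α x 0 = p.1 ∧ sturmian α x m = p.2 := by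
  constructor
  · rintro ⟨i, rfl⟩
    refine ⟨ρ + i * α, ?_, ?_⟩ <;> simp only [sturmian] <;> push_cast <;> ring_nf
  · rintro ⟨x, h0, hm⟩
    obtain ⟨i, hi⟩ := exists_sturmian_eq_iff h ρ x (m + 1)
    refine ⟨i, Prod.ext ?_ ?_⟩
    · simpa [h0] using (hi 0 (by omega)).symm
    · simpa [hm] using (hi m (by omega)).symm

lemma fract_eq_of_eq_add_intCast {y z : ℝ} (M : ℤ) (h : y = z + M) (h0 : 0 ≤ z) (h1 : z < 1) :
    Int.fract y = z :=
  Int.fract_eq_iff.2 ⟨h0, h1, M, by linarith⟩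

lemma Irrational.natCast_mul_ne_intCast {α : ℝ} (h : Irrational α) {m : ℕ} (hm : m ≠ 0) (M : ℤ) :
    (m : ℝ) * α ≠ M := by
  exact_mod_cast (h.natCast_mul hm).ne_int M

lemma Irrational.fract_natCast_mul_pos {α : ℝ} (h : Irrational α) {m : ℕ} (hm : m ≠ 0) :
    0 < Int.fract (m * α) := by
  rw [Int.fract_pos]
  exact h.natCast_mul_ne_intCast hm _

lemma sturmian_eq_zero_of_eq_add_intCast {α ρ z : ℝ} {n : ℕ} (hα : 0 ≤ α) (M : ℤ)
    (h : ρ + n * α = z + M) (h0 : 0 ≤ z) (h1 : z < 1 - α) : sturmian α ρ n = 0 := by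
  rwa [sturmian_eq_zero_iff, fract_eq_of_eq_add_intCast M h h0 (by linarith)]

lemma sturmian_eq_one_of_eq_add_intCast {α ρ z : ℝ} {n : ℕ} (hα : α ≤ 1) (M : ℤ)
    (h : ρ + n * α = z + M) (h0 : 1 - α ≤ z) (h1 : z < 1) : sturmian α ρ n = 1 := by
  rwa [sturmian_eq_one_iff, fract_eq_of_eq_add_intCast M h (by linarith) h1, not_lt]

lemma zero_one_mem_boundarySet1 {α : ℝ} (hα0 : 0 < α) (hα1 : α < 1) (h : Irrational α) (ρ : ℝ)
    {m : ℕ} (hm : m ≠ 0) : (0, 1) ∈ boundarySet1 (sturmian α ρ) m := by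
  rw [mem_boundarySet1_iff h]
  have hpos := h.fract_natCast_mul_pos hm
  have hlt := Int.fract_lt_one (m * α)
  have hadd := Int.fract_add_floor (m * α)
  rcases le_total (Int.fract (m * α)) (1 - α) with hc | hc
  · exact ⟨1 - α - Int.fract (m * α),
      sturmian_eq_zero_of_eq_add_intCast (z := 1 - α - Int.fract (m * α)) hα0.le 0
        (by simp) (by linarith) (by linarith),
      sturmian_eq_one_of_eq_add_intCast (z := 1 - α) hα1.le ⌊m * α⌋
        (by linarith) (by linarith) (by linarith)⟩
  · exact ⟨0,
      sturmian_eq_zero_of_eq_add_intCast (z := 0) hα0.le 0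
        (by simp) (by linarith) (by linarith),
      sturmian_eq_one_of_eq_add_intCast (z := Int.fract (m * α)) hα1.le ⌊m * α⌋
        (by linarith) (by linarith) (by linarith)⟩

lemma one_zero_mem_boundarySet1 {α : ℝ} (hα0 : 0 < α) (hα1 : α < 1) (h : Irrational α) (ρ : ℝ)
    {m : ℕ} (hm : m ≠ 0) : (1, 0) ∈ boundarySet1 (sturmian α ρ) m := by
  rw [mem_boundarySet1_iff h]
  have hpos := h.fract_natCast_mul_pos hm
  have hlt := Int.fract_lt_one (m * α)
  have hadd := Int.fract_add_floor (m * α)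
  rcases le_total (Int.fract (m * α)) α with hc | hc
  · exact ⟨1 - Int.fract (m * α),
      sturmian_eq_one_of_eq_add_intCast (z := 1 - Int.fract (m * α)) hα1.le 0
        (by simp) (by linarith) (by linarith),
      sturmian_eq_zero_of_eq_add_intCast (z := 0) hα0.le (⌊m * α⌋ + 1)
        (by push_cast; linarith) (by linarith) (by linarith)⟩
  · exact ⟨1 - α,
      sturmian_eq_one_of_eq_add_intCast (z := 1 - α) hα1.le 0
        (by simp) (by linarith) (by linarith),
      sturmian_eq_zero_of_eq_add_intCast (z := Int.fract (m * α) - α) hα0.le (⌊m * α⌋ + 1)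
        (by push_cast; linarith) (by linarith) (by linarith)⟩

lemma zero_zero_mem_boundarySet1_iff {α : ℝ} (hα0 : 0 < α) (hα1 : α < 1) (h : Irrational α)
    (ρ : ℝ) (m : ℕ) : (0, 0) ∈ boundarySet1 (sturmian α ρ) m ↔
      Int.fract (m * α) < 1 - α ∨ α < Int.fract (m * α) := by
  rw [mem_boundarySet1_iff h]
  have hnn := Int.fract_nonneg (m * α)
  have hlt := Int.fract_lt_one (m * α)
  have hadd := Int.fract_add_floor (m * α)
  constructor
  · rintro ⟨x, hx0, hxm⟩
    by_contra! hc
    rw [sturmian_eq_zero_iff] at hx0 hxm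
    simp only [Nat.cast_zero, zero_mul, add_zero] at hx0
    have := Int.fract_nonneg x
    have hx := Int.fract_add_floor x
    rw [fract_eq_of_eq_add_intCast (z := Int.fract x + Int.fract (m * α)) (⌊x⌋ + ⌊m * α⌋)
      (by push_cast; linarith) (by linarith) (by linarith)] at hxm
    linarith
  · rintro (hc | hc)
    · exact ⟨0,
        sturmian_eq_zero_of_eq_add_intCast (z := 0) hα0.le 0 (by simp) (by linarith) (by linarith),
        sturmian_eq_zero_of_eq_add_intCast (z := Int.fract (m * α)) hα0.le ⌊m * α⌋
          (by linarith) (by linarith) (by linarith)⟩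
    · exact ⟨1 - Int.fract (m * α),
        sturmian_eq_zero_of_eq_add_intCast (z := 1 - Int.fract (m * α)) hα0.le 0
          (by simp) (by linarith) (by linarith),
        sturmian_eq_zero_of_eq_add_intCast (z := 0) hα0.le (⌊m * α⌋ + 1)
          (by push_cast; linarith) (by linarith) (by linarith)⟩

lemma one_one_mem_boundarySet1_iff {α : ℝ} (hα0 : 0 < α) (hα1 : α < 1) (h : Irrational α)
    (ρ : ℝ) (m : ℕ) : (1, 1) ∈ boundarySet1 (sturmian α ρ) m ↔
      Int.fract (m * α) < α ∨ 1 - α < Int.fract (m * α) := by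
  rw [mem_boundarySet1_iff h]
  have hnn := Int.fract_nonneg (m * α)
  have hlt := Int.fract_lt_one (m * α)
  have hadd := Int.fract_add_floor (m * α)
  constructor
  · rintro ⟨x, hx0, hxm⟩
    by_contra! hc
    rw [sturmian_eq_one_iff] at hx0 hxm
    simp only [Nat.cast_zero, zero_mul, add_zero] at hx0
    have := Int.fract_lt_one x
    have hx := Int.fract_add_floor x
    rw [fract_eq_of_eq_add_intCast (z := Int.fract x + Int.fract (m * α) - 1)
      (⌊x⌋ + ⌊m * α⌋ + 1) (by push_cast; linarith) (by linarith) (by linarith)] at hxm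
    linarith
  · rintro (hc | hc)
    · exact ⟨1 - α,
        sturmian_eq_one_of_eq_add_intCast (z := 1 - α) hα1.le 0
          (by simp) (by linarith) (by linarith),
        sturmian_eq_one_of_eq_add_intCast (z := 1 - α + Int.fract (m * α)) hα1.le ⌊m * α⌋
          (by linarith) (by linarith) (by linarith)⟩
    · exact ⟨2 - α - Int.fract (m * α),
        sturmian_eq_one_of_eq_add_intCast (z := 2 - α - Int.fract (m * α)) hα1.le 0
          (by simp) (by linarith) (by linarith),
        sturmian_eq_one_of_eq_add_intCast (z := 1 - α) hα1.le (⌊m * α⌋ + 1)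
          (by push_cast; linarith) (by linarith) (by linarith)⟩

lemma fract_natCast_mul_lt_iff_of_lt_half {α : ℝ} (hα0 : 0 < α) (hα : α < 1 / 2)
    (h : Irrational α) (k : ℕ) : Int.fract (k * α) < 1 - 2 * α ↔
      ¬ (Int.fract ((k + 1 : ℕ) * α) < α ∨ 1 - α < Int.fract ((k + 1 : ℕ) * α)) := by
  have hnn := Int.fract_nonneg (k * α)
  have hlt := Int.fract_lt_one (k * α)
  have hadd := Int.fract_add_floor (k * α)
  have hne : Int.fract (k * α) ≠ 1 - 2 * α := by
    intro he
    refine h.natCast_mul_ne_intCast (m := k + 2) (by omega) (⌊k * α⌋ + 1) ?_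
    push_cast
    linarith
  rcases lt_or_gt_of_ne hne with hc | hc
  · rw [fract_eq_of_eq_add_intCast (y := (k + 1 : ℕ) * α) (z := Int.fract (k * α) + α) ⌊k * α⌋
      (by push_cast; linarith) (by linarith) (by linarith)]
    exact iff_of_true hc (by push Not; constructor <;> linarith)
  · refine iff_of_false (by linarith) (not_not.2 ?_)
    rcases lt_or_ge (Int.fract (k * α) + α) 1 with hc' | hc'
    · right
      rw [fract_eq_of_eq_add_intCast (z := Int.fract (k * α) + α) ⌊k * α⌋
        (by push_cast; linarith) (by linarith) (by linarith)]
      linarith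
    · left
      rw [fract_eq_of_eq_add_intCast (z := Int.fract (k * α) + α - 1) (⌊k * α⌋ + 1)
        (by push_cast; linarith) (by linarith) (by linarith)]
      linarith

lemma fract_natCast_mul_lt_iff_of_half_lt {α : ℝ} (hα : 1 / 2 < α) (hα1 : α < 1)
    (h : Irrational α) (k : ℕ) : Int.fract (k * (1 - α)) < 1 - 2 * (1 - α) ↔
      ¬ (Int.fract ((k + 1 : ℕ) * α) < 1 - α ∨ α < Int.fract ((k + 1 : ℕ) * α)) := by
  have hnn := Int.fract_nonneg (k * (1 - α))
  have hlt := Int.fract_lt_one (k * (1 - α))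
  have hadd := Int.fract_add_floor (k * (1 - α))
  have hne : Int.fract (k * (1 - α)) ≠ 1 - 2 * (1 - α) := by
    intro he
    refine h.natCast_mul_ne_intCast (m := k + 2) (by omega) (k + 1 - ⌊k * (1 - α)⌋) ?_
    push_cast
    linarith
  rcases lt_or_gt_of_ne hne with hc | hc
  · rw [fract_eq_of_eq_add_intCast (y := (k + 1 : ℕ) * α) (z := α - Int.fract (k * (1 - α)))
      (k - ⌊k * (1 - α)⌋) (by push_cast; linarith) (by linarith) (by linarith)]
    exact iff_of_true hc (by push Not; constructor <;> linarith)
  · refine iff_of_false (by linarith) (not_not.2 ?_)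
    rcases le_or_gt (Int.fract (k * (1 - α))) α with hc' | hc'
    · left
      rw [fract_eq_of_eq_add_intCast (z := α - Int.fract (k * (1 - α)))
        (k - ⌊k * (1 - α)⌋) (by push_cast; linarith) (by linarith) (by linarith)]
      linarith
    · right
      rw [fract_eq_of_eq_add_intCast (z := α - Int.fract (k * (1 - α)) + 1)
        (k - ⌊k * (1 - α)⌋ - 1) (by push_cast; linarith) (by linarith) (by linarith)]
      linarith

open Classical in
/-- The boundary sequence is a coding of the orbit of `0` under the rotation by `min α (1 - α)`. -/
lemma exists_boundarySet1_eq_ite {α : ℝ} (hα0 : 0 < α) (hα1 : α < 1) (h : Irrational α)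
    (ρ : ℝ) : ∃ E : Set (Fin 2 × Fin 2), E ≠ Set.univ ∧ ∀ k : ℕ,
      boundarySet1 (sturmian α ρ) (k + 1) =
        if Int.fract (k * min α (1 - α)) < 1 - 2 * min α (1 - α) then E else Set.univ := by
  have h01 (k : ℕ) := zero_one_mem_boundarySet1 hα0 hα1 h ρ k.succ_ne_zero
  have h10 (k : ℕ) := one_zero_mem_boundarySet1 hα0 hα1 h ρ k.succ_ne_zero
  have h00 (k : ℕ) := zero_zero_mem_boundarySet1_iff hα0 hα1 h ρ (k + 1)
  have h11 (k : ℕ) := one_one_mem_boundarySet1_iff hα0 hα1 h ρ (k + 1)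
  have hne : α ≠ 1 / 2 := fun he => h.natCast_mul_ne_intCast two_ne_zero 1 (by simp [he])
  rcases lt_or_gt_of_ne hne with hα | hα
  · refine ⟨{(1, 1)}ᶜ, by simp, fun k => ?_⟩
    rw [min_eq_left (by linarith)]
    have key := fract_natCast_mul_lt_iff_of_lt_half hα0 hα h k
    rw [← h11] at key
    have h00' : (0, 0) ∈ boundarySet1 (sturmian α ρ) (k + 1) := by
      rw [h00]
      by_contra! hc
      linarith
    specialize h01 k
    specialize h10 k
    clear h00 h11
    split_ifs with hc <;> ext ⟨b, c⟩ <;> fin_cases b <;> fin_cases c <;> simp_all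
  · refine ⟨{(0, 0)}ᶜ, by simp, fun k => ?_⟩
    rw [min_eq_right (by linarith)]
    have key := fract_natCast_mul_lt_iff_of_half_lt hα hα1 h k
    rw [← h00] at key
    have h11' : (1, 1) ∈ boundarySet1 (sturmian α ρ) (k + 1) := by
      rw [h11]
      by_contra! hc
      linarith
    specialize h01 k
    specialize h10 k
    clear h00 h11
    split_ifs with hc <;> ext ⟨b, c⟩ <;> fin_cases b <;> fin_cases c <;> simp_all

lemma zeroOnePowOccurs_iff_exists {α : ℝ} (h : Irrational α) (ρ : ℝ) (R : ℕ) :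
    zeroOnePowOccurs (sturmian α ρ) R ↔
      ∃ x : ℝ, ∀ j < R, sturmian α x (2 * j) = 0 ∧ sturmian α x (2 * j + 1) = 1 := by
  constructor
  · rintro ⟨i, hi⟩
    refine ⟨ρ + i * α, fun j hj => ?_⟩
    convert hi j hj using 2 <;> simp only [sturmian] <;> push_cast <;> ring_nf
  · rintro ⟨x, hx⟩
    obtain ⟨i, hi⟩ := exists_sturmian_eq_iff h ρ x (2 * R)
    refine ⟨i, fun j hj => ?_⟩
    rw [add_assoc, hi (2 * j) (by omega), hi (2 * j + 1) (by omega)]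
    exact hx j hj

lemma zeroOnePowOccurs_iff_of_lt_half {α : ℝ} (hα0 : 0 < α) (hα : α < 1 / 2) (h : Irrational α)
    (ρ : ℝ) (r : ℕ) :
    zeroOnePowOccurs (sturmian α ρ) (r + 1) ↔ r * (1 - 2 * α) < α := by
  rw [zeroOnePowOccurs_iff_exists h]
  constructor
  · rintro ⟨x, hx⟩
    have hadd := Int.fract_add_floor x
    have key : ∀ j ≤ r, 1 - 2 * α ≤ Int.fract x - j * (1 - 2 * α) ∧
        Int.fract x - j * (1 - 2 * α) < 1 - α := by
      intro j hj
      induction j with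
      | zero =>
        obtain ⟨h0, h1⟩ := hx 0 (by omega)
        rw [sturmian_eq_zero_iff] at h0
        rw [sturmian_eq_one_iff] at h1
        simp only [mul_zero, Nat.cast_zero, zero_mul, add_zero, zero_add, Nat.cast_one, one_mul,
          sub_zero] at h0 h1 ⊢
        refine ⟨?_, h0⟩
        have := Int.fract_nonneg x
        rw [fract_eq_of_eq_add_intCast (z := Int.fract x + α) ⌊x⌋ (by linarith) (by linarith)
          (by linarith)] at h1
        linarith
      | succ j ih =>
        obtain ⟨ih0, ih1⟩ := ih (by omega)
        obtain ⟨h0, h1⟩ := hx (j + 1) (by omega)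
        rw [sturmian_eq_zero_iff] at h0
        rw [sturmian_eq_one_iff] at h1
        push_cast at h0 h1 ⊢
        rw [fract_eq_of_eq_add_intCast (z := Int.fract x - j * (1 - 2 * α) - (1 - 2 * α))
          (⌊x⌋ + j + 1) (by push_cast; linarith) (by linarith) (by linarith)] at h0
        rw [fract_eq_of_eq_add_intCast (z := Int.fract x - j * (1 - 2 * α) - (1 - 2 * α) + α)
          (⌊x⌋ + j + 1) (by push_cast; linarith) (by linarith) (by linarith)] at h1
        constructor <;> linarith
    have h0 := (key 0 (by omega)).2
    have hr := (key r le_rfl).1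
    simp only [Nat.cast_zero, zero_mul, sub_zero] at h0
    linarith
  · intro hr
    refine ⟨(r + 1) * (1 - 2 * α), fun j hj => ?_⟩
    have h1 : 0 ≤ (r - j : ℝ) * (1 - 2 * α) :=
      mul_nonneg (sub_nonneg.2 (by exact_mod_cast Nat.lt_succ_iff.1 hj)) (by linarith)
    have h2 : 0 ≤ j * (1 - 2 * α) := mul_nonneg (by positivity) (by linarith)
    constructor
    · exact sturmian_eq_zero_of_eq_add_intCast (z := (r + 1 - j) * (1 - 2 * α)) hα0.le j
        (by push_cast; ring) (by linarith) (by linarith)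
    · exact sturmian_eq_one_of_eq_add_intCast (z := (r + 1 - j) * (1 - 2 * α) + α)
        (by linarith) j (by push_cast; ring) (by linarith) (by linarith)

lemma zeroOnePowOccurs_iff_of_half_lt {α : ℝ} (hα : 1 / 2 < α) (hα1 : α < 1) (h : Irrational α)
    (ρ : ℝ) (r : ℕ) :
    zeroOnePowOccurs (sturmian α ρ) (r + 1) ↔ r * (1 - 2 * (1 - α)) < 1 - α := by
  rw [zeroOnePowOccurs_iff_exists h]
  constructor
  · rintro ⟨x, hx⟩
    have hnn := Int.fract_nonneg x
    have hadd := Int.fract_add_floor x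
    have key : ∀ j ≤ r, Int.fract x + j * (1 - 2 * (1 - α)) < 1 - α := by
      intro j hj
      have h0 := (hx j (by omega)).1
      rw [sturmian_eq_zero_iff] at h0
      induction j with
      | zero => simpa using h0
      | succ j ih =>
        have ih := ih (by omega) (sturmian_eq_zero_iff.1 (hx j (by omega)).1)
        have h2 : 0 ≤ j * (1 - 2 * (1 - α)) := mul_nonneg (by positivity) (by linarith)
        push_cast at h0 ⊢
        rwa [fract_eq_of_eq_add_intCast (z := Int.fract x + (j + 1) * (1 - 2 * (1 - α)))
          (⌊x⌋ + j + 1) (by push_cast; linarith) (by linarith) (by linarith)] at h0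
    linarith [key r le_rfl]
  · intro hr
    refine ⟨0, fun j hj => ?_⟩
    have h1 : 0 ≤ (r - j : ℝ) * (1 - 2 * (1 - α)) :=
      mul_nonneg (sub_nonneg.2 (by exact_mod_cast Nat.lt_succ_iff.1 hj)) (by linarith)
    have h2 : 0 ≤ j * (1 - 2 * (1 - α)) := mul_nonneg (by positivity) (by linarith)
    constructor
    · exact sturmian_eq_zero_of_eq_add_intCast (z := j * (1 - 2 * (1 - α))) (by linarith) j
        (by push_cast; ring) (by linarith) (by linarith)
    · exact sturmian_eq_one_of_eq_add_intCast (z := j * (1 - 2 * (1 - α)) + α)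
        hα1.le j (by push_cast; ring) (by linarith) (by linarith)

lemma zeroOnePowOccurs_iff {α : ℝ} (hα0 : 0 < α) (hα1 : α < 1) (h : Irrational α) (ρ : ℝ)
    (r : ℕ) : zeroOnePowOccurs (sturmian α ρ) (r + 1) ↔
      r * (1 - 2 * min α (1 - α)) < min α (1 - α) := by
  have hne : α ≠ 1 / 2 := fun he => h.natCast_mul_ne_intCast two_ne_zero 1 (by simp [he])
  rcases lt_or_gt_of_ne hne with hα | hα
  · rw [min_eq_left (by linarith), zeroOnePowOccurs_iff_of_lt_half hα0 hα h]
  · rw [min_eq_right (by linarith), zeroOnePowOccurs_iff_of_half_lt hα hα1 h]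

section RotationWords

variable {a : ℝ}

lemma exists_fract_add_eq_sub_intCast (z : ℝ) {x : ℝ} :
    ∃ M : ℤ, Int.fract (z + x) = Int.fract z + x - M := by
  refine ⟨⌊z + x⌋ - ⌊z⌋, ?_⟩
  rw [← Int.self_sub_floor, ← Int.self_sub_floor]
  push_cast
  ring

/-- Two visits of the rotation to `[0, 1 - 2a)` are at least `2r - 1` steps apart. -/
lemma not_fract_lt_of_fract_lt {r : ℕ} (hlt : ((r : ℝ) - 1) * (1 - 2 * a) < a)
    (ha : a < 1 / 2) {t : ℕ} (ht0 : 0 < t) (ht : t + 1 < 2 * r) {z : ℝ}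
    (hz : Int.fract z < 1 - 2 * a) : ¬ Int.fract (z + t * a) < 1 - 2 * a := by
  intro hz'
  obtain ⟨M, hM⟩ := exists_fract_add_eq_sub_intCast z (x := t * a)
  have h0 := Int.fract_nonneg z
  have h0' := Int.fract_nonneg (z + t * a)
  rcases Nat.even_or_odd' t with ⟨j, rfl | rfl⟩
  · have hj1 : (1 : ℝ) ≤ j := by exact_mod_cast (by omega : 1 ≤ j)
    have hjr : (j : ℝ) + 1 ≤ r := by exact_mod_cast (by omega : j + 1 ≤ r)
    have h1 := mul_le_mul_of_nonneg_right hj1 (show 0 ≤ 1 - 2 * a by linarith)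
    have h2 := mul_le_mul_of_nonneg_right hjr (show 0 ≤ 1 - 2 * a by linarith)
    push_cast at hM h0' hz'
    have hM0 : ((0 : ℤ) : ℝ) < ((j - M : ℤ) : ℝ) := by push_cast; linarith
    have hM1 : ((j - M : ℤ) : ℝ) < ((1 : ℤ) : ℝ) := by push_cast; linarith
    rw [Int.cast_lt] at hM0 hM1
    omega
  · have hj0 : (0 : ℝ) ≤ j := by positivity
    have hjr : (j : ℝ) + 2 ≤ r := by exact_mod_cast (by omega : j + 2 ≤ r)
    have h1 := mul_nonneg hj0 (show 0 ≤ 1 - 2 * a by linarith)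
    have h2 := mul_le_mul_of_nonneg_right hjr (show 0 ≤ 1 - 2 * a by linarith)
    push_cast at hM h0' hz'
    have hM0 : ((-1 : ℤ) : ℝ) < ((j - M : ℤ) : ℝ) := by push_cast; linarith
    have hM1 : ((j - M : ℤ) : ℝ) < ((0 : ℤ) : ℝ) := by push_cast; linarith
    rw [Int.cast_lt] at hM0 hM1
    omega

/-- The orbit of `r (1 - 2a)` avoids `[0, 1 - 2a)` for `2r - 1` steps. -/
lemma le_fract_natCast_mul_add {r : ℕ} (hlt : ((r : ℝ) - 1) * (1 - 2 * a) < a) (ha0 : 0 < a)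
    (ha : a < 1 / 2) {k : ℕ} (hk : k + 1 < 2 * r) :
    1 - 2 * a ≤ Int.fract (r * (1 - 2 * a) + k * a) := by
  rcases Nat.even_or_odd' k with ⟨j, rfl | rfl⟩
  · have hj0 : (0 : ℝ) ≤ j := by positivity
    have hjr : (j : ℝ) + 1 ≤ r := by exact_mod_cast (by omega : j + 1 ≤ r)
    have h1 := mul_nonneg hj0 (show 0 ≤ 1 - 2 * a by linarith)
    have h2 := mul_le_mul_of_nonneg_right hjr (show 0 ≤ 1 - 2 * a by linarith)
    rw [fract_eq_of_eq_add_intCast (z := (r - j) * (1 - 2 * a)) j (by push_cast; ring)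
      (by linarith) (by linarith)]
    linarith
  · have hj0 : (0 : ℝ) ≤ j := by positivity
    have hjr : (j : ℝ) + 1 ≤ r := by exact_mod_cast (by omega : j + 1 ≤ r)
    have h1 := mul_nonneg hj0 (show 0 ≤ 1 - 2 * a by linarith)
    have h2 := mul_le_mul_of_nonneg_right hjr (show 0 ≤ 1 - 2 * a by linarith)
    rw [fract_eq_of_eq_add_intCast (z := (r - j) * (1 - 2 * a) + a) j (by push_cast; ring)
      (by linarith) (by linarith)]
    linarith

lemma rotationWords_eq_range {r n : ℕ} (hlt : ((r : ℝ) - 1) * (1 - 2 * a) < a) (ha0 : 0 < a)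
    (ha : a < 1 / 2) (hn : n < 2 * r) :
    rotationWords a (1 - 2 * a) n = Set.range fun (j : Fin (n + 1)) (k : Fin n) => (k : ℕ) = j := by
  have shift (z : ℝ) (k l : ℕ) (hkl : k ≤ l) : z + l * a = z + k * a + (l - k : ℕ) * a := by
    push_cast [hkl]; ring
  have unique : ∀ {z : ℝ} {k l : ℕ}, k < l → l < n → Int.fract (z + k * a) < 1 - 2 * a →
      ¬ Int.fract (z + l * a) < 1 - 2 * a := by
    intro z k l hkl hl hk
    rw [shift z k l hkl.le]
    exact not_fract_lt_of_fract_lt hlt ha (by omega) (by omega) hk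
  apply Set.Subset.antisymm
  · rintro _ ⟨z, rfl⟩
    by_cases hex : ∃ j : Fin n, Int.fract (z + j * a) < 1 - 2 * a
    · obtain ⟨j, hj⟩ := hex
      refine ⟨j.castSucc, funext fun k => propext ?_⟩
      constructor
      · intro hk
        rw [Fin.ext (show (k : ℕ) = j from hk)]
        exact hj
      · intro hk
        rcases lt_trichotomy (k : ℕ) j with hkj | hkj | hkj
        · exact absurd hj (unique hkj j.2 hk)
        · exact hkj
        · exact absurd hk (unique hkj k.2 hj)
    · refine ⟨Fin.last n, funext fun k => propext ?_⟩
      exact iff_of_false (by simpa using k.2.ne) fun hk => hex ⟨k, hk⟩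
  · rintro _ ⟨j, rfl⟩
    rcases lt_or_eq_of_le (Nat.lt_succ_iff.1 j.2) with hj | hj
    · have hz : Int.fract (-(j * a) + (j : ℕ) * a) < 1 - 2 * a := by
        rw [neg_add_cancel, Int.fract_zero]; linarith
      refine ⟨-(j * a), funext fun k => propext ?_⟩
      constructor
      · intro hk
        rcases lt_trichotomy (k : ℕ) j with hkj | hkj | hkj
        · exact absurd hz (unique hkj hj hk)
        · exact hkj
        · exact absurd hk (unique hkj k.2 hz)
      · intro hk
        simpa only [show (k : ℕ) = j from hk] using hz
    · refine ⟨r * (1 - 2 * a), funext fun k => propext ?_⟩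
      refine iff_of_false (not_lt.2 ?_) (by have := k.2; omega)
      exact le_fract_natCast_mul_add hlt ha0 ha (by have := k.2; omega)

lemma ncard_rotationWords_of_lt {r n : ℕ} (hlt : ((r : ℝ) - 1) * (1 - 2 * a) < a) (ha0 : 0 < a)
    (ha : a < 1 / 2) (hn : n < 2 * r) :
    (rotationWords a (1 - 2 * a) n).ncard = n + 1 := by
  rw [rotationWords_eq_range hlt ha0 ha hn, ← Set.image_univ, Set.ncard_image_of_injective,
    Set.ncard_univ, Nat.card_fin]
  intro i j hij
  by_contra hne
  wlog hlt' : i < j generalizing i j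
  · exact this hij.symm (Ne.symm hne) (lt_of_le_of_ne (not_lt.1 hlt') (Ne.symm hne))
  have := iff_of_eq (congrFun hij ⟨i, by omega⟩)
  exact hne (Fin.ext (this.mp rfl))

lemma floor_add_eq_of_mem_Ico {z : ℝ} (hz : z ∈ Set.Ico (0 : ℝ) 1) (x : ℝ) :
    ⌊z + x⌋ = (if Int.fract (-x) ≤ z then 0 else -1) - ⌊-x⌋ := by
  have h := Int.fract_add_floor (-x)
  have h0 := Int.fract_nonneg (-x)
  have h1 := Int.fract_lt_one (-x)
  obtain ⟨hz0, hz1⟩ := hz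
  rw [Int.floor_eq_iff]
  split_ifs with hc <;> push_cast <;> constructor <;> linarith

/-- The letters of the Sturmian word through `z` follow each other according to the visits to
`[0, 1 - 2a)`. -/
lemma le_fract_succ_iff (ha0 : 0 < a) (ha : a < 1 / 2) (z : ℝ) (k : ℕ) :
    1 - a ≤ Int.fract (z + (k + 1 : ℕ) * a) ↔
      ¬ 1 - a ≤ Int.fract (z + k * a) ∧ ¬ Int.fract (z + k * a) < 1 - 2 * a := by
  have h0 := Int.fract_nonneg (z + k * a)
  have h1 := Int.fract_lt_one (z + k * a)
  have hadd := Int.fract_add_floor (z + k * a)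
  rcases lt_or_ge (Int.fract (z + k * a)) (1 - a) with hc | hc
  · rw [fract_eq_of_eq_add_intCast (y := z + (k + 1 : ℕ) * a) (z := Int.fract (z + k * a) + a)
      ⌊z + k * a⌋ (by push_cast; linarith) (by linarith) (by linarith), not_le, not_lt]
    exact ⟨fun _ => ⟨by linarith, by linarith⟩, fun _ => by linarith⟩
  · rw [fract_eq_of_eq_add_intCast (y := z + (k + 1 : ℕ) * a)
      (z := Int.fract (z + k * a) + a - 1)
      (⌊z + k * a⌋ + 1) (by push_cast; linarith) (by linarith) (by linarith)]
    exact iff_of_false (by linarith) fun h => h.1 hc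

lemma floor_succ_eq (ha0 : 0 < a) (ha1 : a < 1) (z : ℝ) (k : ℕ)
    [Decidable (1 - a ≤ Int.fract (z + k * a))] :
    ⌊z + (k + 1 : ℕ) * a⌋ =
      ⌊z + k * a⌋ + if 1 - a ≤ Int.fract (z + k * a) then 1 else 0 := by
  have h0 := Int.fract_nonneg (z + k * a)
  have h1 := Int.fract_lt_one (z + k * a)
  have hadd := Int.fract_add_floor (z + k * a)
  rw [Int.floor_eq_iff]
  split_ifs with hc <;> push_cast <;> constructor <;> linarith

lemma lt_of_forall_le_fract (ha0 : 0 < a) (ha : a < 1 / 2) {z : ℝ} {r : ℕ}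
    (h : ∀ j ≤ r, 1 - a ≤ Int.fract (z + (2 * j : ℕ) * a)) : r * (1 - 2 * a) < a := by
  have hadd := Int.fract_add_floor z
  have h1 := Int.fract_lt_one z
  have key : ∀ j ≤ r, 1 - a ≤ Int.fract z - j * (1 - 2 * a) := by
    intro j hj
    have hj' := h j hj
    induction j with
    | zero => simpa using hj'
    | succ j ih =>
      have ih := ih (by omega) (h j (by omega))
      have h2 : 0 ≤ j * (1 - 2 * a) := mul_nonneg (by positivity) (by linarith)
      push_cast at hj' ⊢
      rwa [fract_eq_of_eq_add_intCast (z := Int.fract z - (j + 1) * (1 - 2 * a))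
        (⌊z⌋ + j + 1) (by push_cast; linarith) (by linarith) (by linarith)] at hj'
  linarith [key r le_rfl]

/-- A long enough coding with respect to `[0, 1 - 2a)` determines the Sturmian letters. -/
lemma le_fract_iff_of_forall_fract_lt_iff {r n : ℕ} (hle : a ≤ r * (1 - 2 * a)) (ha0 : 0 < a)
    (ha : a < 1 / 2) (hn : 2 * r ≤ n) {z z' : ℝ}
    (h : ∀ k < n, Int.fract (z + k * a) < 1 - 2 * a ↔ Int.fract (z' + k * a) < 1 - 2 * a) :
    ∀ k ≤ n, 1 - a ≤ Int.fract (z + k * a) ↔ 1 - a ≤ Int.fract (z' + k * a) := by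
  by_cases h0 : 1 - a ≤ Int.fract (z + (0 : ℕ) * a) ↔ 1 - a ≤ Int.fract (z' + (0 : ℕ) * a)
  · intro k hk
    induction k with
    | zero => exact h0
    | succ k ih =>
      rw [le_fract_succ_iff ha0 ha, le_fract_succ_iff ha0 ha, ih (by omega), h k (by omega)]
  · exfalso
    wlog hz : 1 - a ≤ Int.fract (z + (0 : ℕ) * a) generalizing z z'
    · exact this (fun k hk => (h k hk).symm) (fun h' => h0 h'.symm) (by tauto)
    have hopp : ∀ k ≤ n, 1 - a ≤ Int.fract (z + k * a) ↔ ¬ 1 - a ≤ Int.fract (z' + k * a) := by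
      intro k hk
      induction k with
      | zero => tauto
      | succ k ih =>
        have ih := ih (by omega)
        have hk := h k (by omega)
        have hw : Int.fract (z + k * a) < 1 - 2 * a → ¬ 1 - a ≤ Int.fract (z + k * a) :=
          fun _ => by linarith
        have hw' : Int.fract (z' + k * a) < 1 - 2 * a → ¬ 1 - a ≤ Int.fract (z' + k * a) :=
          fun _ => by linarith
        rw [le_fract_succ_iff ha0 ha, le_fract_succ_iff ha0 ha]
        tauto
    have halt : ∀ k < n, 1 - a ≤ Int.fract (z + (k + 1 : ℕ) * a) ↔
        ¬ 1 - a ≤ Int.fract (z + k * a) := by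
      intro k hk
      have ho := hopp k hk.le
      have hk := h k hk
      have hw : Int.fract (z + k * a) < 1 - 2 * a → ¬ 1 - a ≤ Int.fract (z + k * a) :=
        fun _ => by linarith
      have hw' : Int.fract (z' + k * a) < 1 - 2 * a → ¬ 1 - a ≤ Int.fract (z' + k * a) :=
        fun _ => by linarith
      rw [le_fract_succ_iff ha0 ha]
      tauto
    refine hle.not_gt (lt_of_forall_le_fract (z := z) ha0 ha fun j hj => ?_)
    induction j with
    | zero => exact hz
    | succ j ih =>
      rw [show 2 * (j + 1) = 2 * j + 1 + 1 by ring, halt _ (by omega), halt _ (by omega), not_not]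
      exact ih (by omega)

/-- The points where the coding of length `n` by the Sturmian partition jumps. -/
noncomputable def jumpPoints (a : ℝ) (n : ℕ) : Finset ℝ :=
  (Finset.range n).image fun k : ℕ => Int.fract (-(k * a))

lemma card_jumpPoints (h : Irrational a) (n : ℕ) : (jumpPoints a n).card = n := by
  rw [jumpPoints, Finset.card_image_of_injective, Finset.card_range]
  intro k l hkl
  obtain ⟨M, hM⟩ := Int.fract_eq_fract.1 hkl
  by_contra hne
  wlog hlt : k < l generalizing k l M
  · exact this hkl.symm (-M) (by push_cast; linarith) (Ne.symm hne) (by omega)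
  refine h.natCast_mul_ne_intCast (m := l - k) (by omega) M ?_
  push_cast [hlt.le]
  linarith

lemma mem_Ico_of_mem_jumpPoints {n : ℕ} {p : ℝ} (hp : p ∈ jumpPoints a n) :
    p ∈ Set.Ico (0 : ℝ) 1 := by
  obtain ⟨k, -, rfl⟩ := Finset.mem_image.1 hp
  exact ⟨Int.fract_nonneg _, Int.fract_lt_one _⟩

lemma zero_mem_jumpPoints {n : ℕ} (hn : 0 < n) : 0 ∈ jumpPoints a n :=
  Finset.mem_image.2 ⟨0, Finset.mem_range.2 hn, by simp⟩

lemma exists_jumpPoint_floor_eq {n : ℕ} (hn : 0 < n) {z : ℝ} (hz : z ∈ Set.Ico (0 : ℝ) 1) :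
    ∃ p ∈ jumpPoints a n, ∀ k < n, ⌊p + k * a⌋ = ⌊z + k * a⌋ := by
  obtain ⟨p, hp, hmax⟩ := ((jumpPoints a n).filter (· ≤ z)).exists_max_image id
    ⟨0, Finset.mem_filter.2 ⟨zero_mem_jumpPoints hn, hz.1⟩⟩
  obtain ⟨hp, hpz⟩ := Finset.mem_filter.1 hp
  refine ⟨p, hp, fun k hk => ?_⟩
  rw [floor_add_eq_of_mem_Ico (mem_Ico_of_mem_jumpPoints hp), floor_add_eq_of_mem_Ico hz]
  have : Int.fract (-(k * a)) ≤ p ↔ Int.fract (-(k * a)) ≤ z :=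
    ⟨fun h' => h'.trans hpz, fun h' => hmax _ (Finset.mem_filter.2
      ⟨Finset.mem_image.2 ⟨k, Finset.mem_range.2 hk, rfl⟩, h'⟩)⟩
  simp only [this]

lemma eq_of_floor_eq_of_mem_jumpPoints {n : ℕ} {p q : ℝ} (hp : p ∈ jumpPoints a n)
    (hq : q ∈ jumpPoints a n) (h : ∀ k < n, ⌊p + k * a⌋ = ⌊q + k * a⌋) : p = q := by
  wlog hpq : q ≤ p generalizing p q
  · exact (this hq hp (fun k hk => (h k hk).symm) (not_le.1 hpq).le).symm
  obtain ⟨k, hk, rfl⟩ := Finset.mem_image.1 hp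
  have hk := h k (Finset.mem_range.1 hk)
  rw [floor_add_eq_of_mem_Ico (mem_Ico_of_mem_jumpPoints hp),
    floor_add_eq_of_mem_Ico (mem_Ico_of_mem_jumpPoints hq), if_pos le_rfl] at hk
  refine le_antisymm ?_ hpq
  by_contra hc
  rw [if_neg hc] at hk
  omega

lemma floor_eq_of_forall_le_fract_iff (ha0 : 0 < a) (ha1 : a < 1) {n : ℕ} {z z' : ℝ}
    (h0 : ⌊z⌋ = ⌊z'⌋)
    (h : ∀ k < n, 1 - a ≤ Int.fract (z + k * a) ↔ 1 - a ≤ Int.fract (z' + k * a)) :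
    ∀ k ≤ n, ⌊z + k * a⌋ = ⌊z' + k * a⌋ := by
  intro k hk
  induction k with
  | zero => simpa using h0
  | succ k ih =>
    classical
    rw [floor_succ_eq ha0 ha1, floor_succ_eq ha0 ha1, ih (by omega)]
    simp only [h k (by omega)]

lemma fract_lt_iff_floor_eq (ha0 : 0 < a) (z : ℝ) (k : ℕ) :
    Int.fract (z + k * a) < 1 - 2 * a ↔ ⌊z + (k + 2 : ℕ) * a⌋ = ⌊z + k * a⌋ := by
  have h0 := Int.fract_nonneg (z + k * a)
  have hadd := Int.fract_add_floor (z + k * a)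
  rw [Int.floor_eq_iff]
  push_cast
  constructor
  · intro hk
    constructor <;> linarith
  · rintro ⟨-, hk⟩
    linarith

lemma ncard_rotationWords_of_le {r n : ℕ} (h : Irrational a) (hle : a ≤ r * (1 - 2 * a))
    (ha0 : 0 < a) (ha : a < 1 / 2) (hn : 2 * r ≤ n) :
    (rotationWords a (1 - 2 * a) n).ncard = n + 2 := by
  have himage : rotationWords a (1 - 2 * a) n =
      (fun (z : ℝ) (k : Fin n) => Int.fract (z + k * a) < 1 - 2 * a) '' jumpPoints a (n + 2) := by
    refine Set.Subset.antisymm ?_ (Set.image_subset_range _ _)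
    rintro _ ⟨z, rfl⟩
    obtain ⟨p, hp, hpz⟩ := exists_jumpPoint_floor_eq (a := a) (show 0 < n + 2 by omega)
      ⟨Int.fract_nonneg z, Int.fract_lt_one z⟩
    refine ⟨p, hp, funext fun k => propext ?_⟩
    have hk := k.2
    change Int.fract (p + (k : ℕ) * a) < 1 - 2 * a ↔ Int.fract (z + (k : ℕ) * a) < 1 - 2 * a
    rw [fract_lt_iff_floor_eq ha0, hpz _ (by omega), hpz _ (by omega),
      ← fract_lt_iff_floor_eq ha0, ← Int.fract_add_intCast _ ⌊z⌋]
    rw [add_right_comm, Int.fract_add_floor]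
  rw [himage, Set.InjOn.ncard_image, Set.ncard_coe_finset, card_jumpPoints h]
  intro p hp q hq hpq
  have hfloor {x : ℝ} (hx : x ∈ jumpPoints a (n + 2)) : ⌊x⌋ = 0 :=
    Int.floor_eq_zero_iff.2 (mem_Ico_of_mem_jumpPoints hx)
  refine eq_of_floor_eq_of_mem_jumpPoints hp hq fun k hk => ?_
  refine floor_eq_of_forall_le_fract_iff (n := n + 1) ha0 (by linarith)
    ((hfloor hp).trans (hfloor hq).symm) (fun l hl => ?_) k (by omega)
  exact le_fract_iff_of_forall_fract_lt_iff hle ha0 ha hn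
    (fun m hm => iff_of_eq (congrFun hpq ⟨m, hm⟩)) l (by omega)

end RotationWords

/-- let `s` be a Sturmian word of irrational slope `α ∈ (0,1)` and
intercept `ρ`, and let `r ≥ 1` be maximal such that `(01)^r` occurs in `s`. Then the
boundary sequence `y[n] = ∂_s[n+1]` has factor complexity `p_y(n) = n + 1` for
`1 ≤ n < 2r` and `p_y(n) = n + 2` for `n ≥ 2r`. -/
theorem stmt19 (α : ℝ) (hα0 : 0 < α) (hα1 : α < 1) (hirr : Irrational α)
    (ρ : ℝ) (hρ0 : 0 ≤ ρ) (hρ1 : ρ < 1) (r : ℕ) (hr : 1 ≤ r)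
    (hocc : zeroOnePowOccurs (sturmian α ρ) r)
    (hmax : ¬ zeroOnePowOccurs (sturmian α ρ) (r + 1)) :
    ∀ n : ℕ, 1 ≤ n →
      {u : Fin n → Set (Fin 2 × Fin 2) |
        ∃ i : ℕ, ∀ k : Fin n, u k = boundarySet1 (sturmian α ρ) (i + k + 1)}.ncard =
        if n < 2 * r then n + 1 else n + 2 := by
  intro n _
  obtain ⟨r, rfl⟩ := Nat.exists_eq_add_of_le' hr
  rw [zeroOnePowOccurs_iff hα0 hα1 hirr] at hocc hmax
  obtain ⟨E, hE, hbd⟩ := exists_boundarySet1_eq_ite hα0 hα1 hirr ρ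
  have hne : α ≠ 1 / 2 := fun he => hirr.natCast_mul_ne_intCast two_ne_zero 1 (by simp [he])
  have ha0 : 0 < min α (1 - α) := lt_min hα0 (by linarith)
  have ha : min α (1 - α) < 1 / 2 := by
    rcases lt_or_gt_of_ne hne with hα | hα
    · exact (min_le_left _ _).trans_lt hα
    · exact (min_le_right _ _).trans_lt (by linarith)
  have hirr' : Irrational (min α (1 - α)) := by
    rcases min_choice α (1 - α) with he | he <;> rw [he]
    · exact hirr
    · exact_mod_cast hirr.natCast_sub 1
  generalize min α (1 - α) = a at *
  classical
  have himage : {u : Fin n → Set (Fin 2 × Fin 2) |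
      ∃ i : ℕ, ∀ k : Fin n, u k = boundarySet1 (sturmian α ρ) (i + k + 1)} =
      (fun (w : Fin n → Prop) k => if w k then E else Set.univ) ''
        rotationWords a (1 - 2 * a) n := by
    ext u
    constructor
    · rintro ⟨i, hi⟩
      refine ⟨_, ⟨i * a, rfl⟩, funext fun k => ?_⟩
      rw [hi, hbd]
      push_cast
      simp only [add_mul]
    · rintro ⟨_, ⟨z, rfl⟩, rfl⟩
      obtain ⟨i, hi⟩ := exists_nat_fract_lt_iff hirr' 0 (1 - 2 * a) z n
      refine ⟨i, fun k => ?_⟩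
      rw [hbd]
      simp only [← hi k k.2, zero_add]
  rw [himage, Set.ncard_image_of_injective]
  · split_ifs with hn
    · exact ncard_rotationWords_of_lt (by simpa using hocc) ha0 ha hn
    · exact ncard_rotationWords_of_le hirr' (not_lt.1 hmax) ha0 ha (not_lt.1 hn)
  · intro w w' hw
    funext k
    have hk := congrFun hw k
    by_cases h1 : w k <;> by_cases h2 : w' k <;> simp_all [Ne.symm hE]
end
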